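/- arXiv:1906.09794 — 4 statements merged into one kernel-verified Lean document; each statement's English description precedes it below -/
import Mathlib

section
/- There exists a constant c > 0 such that for all integers k ≥ 3 and r ≥ 2 the following holds: if F ⊆ F₂^k × F₂^k is a set of pairs (u,v) with ⟨u,v⟩ = 1 for every (u,v) ∈ F, and |F| ≥ c · 2^{3k/2 + 2r} (with 2^{3k/2+2r} a real power of 2), then there exist r distinct pairs (u₁,v₁), …, (u_r,v_r) ∈ F such that ⟨u_i, v_j⟩ = 0 over F₂ whenever i ≠ j. -/
open Finset BigOperators

/-- The nontrivial character of `ZMod 2`, with real values. -/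
def binarySign (t : ZMod 2) : ℝ := if t = 0 then 1 else -1

lemma binarySign_add (s t : ZMod 2) : binarySign (s + t) = binarySign s * binarySign t := by
  have key : ∀ s t : ZMod 2, s + t = 0 ↔ (s = 0 ↔ t = 0) := by decide
  by_cases hs : s = 0 <;> by_cases ht : t = 0 <;> simp [binarySign, key, hs, ht]

lemma sum_binarySign_dotProduct {k : ℕ} (w : Fin k → ZMod 2) :
    ∑ u : Fin k → ZMod 2, binarySign (w ⬝ᵥ u) = if w = 0 then (2 : ℝ) ^ k else 0 := by
  split_ifs with h
  · subst h
    simp [binarySign, ZMod.card]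
  · obtain ⟨i, hi⟩ := Function.ne_iff.mp h
    have hw : w i = 1 := by
      have : ∀ t : ZMod 2, t ≠ 0 → t = 1 := by decide
      exact this _ hi
    have key : ∑ u : Fin k → ZMod 2, binarySign (w ⬝ᵥ u)
        = ∑ u : Fin k → ZMod 2, -binarySign (w ⬝ᵥ u) := by
      refine (Fintype.sum_equiv (Equiv.addRight (Pi.single i 1)) _ _ fun u => ?_)
      have h1 : binarySign 1 = -1 := by simp [binarySign]
      simp [dotProduct_add, binarySign_add, hw, h1]
    rw [Finset.sum_neg_distrib] at key
    linarith

/-- Lindsey's inequality for a kernel with orthogonal rows of equal norm. -/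
lemma sq_sum_mul_kernel_le {α β : Type*} [Fintype α] [Fintype β] [DecidableEq α]
    (K : α → β → ℝ) (N : ℝ)
    (hK : ∀ a a', ∑ b, K a b * K a' b = if a = a' then N else 0) (f : α → ℝ) (g : β → ℝ) :
    (∑ b, g b * ∑ a, f a * K a b) ^ 2 ≤ N * (∑ a, f a ^ 2) * ∑ b, g b ^ 2 := by
  refine (Finset.sum_mul_sq_le_sq_mul_sq _ _ _).trans (le_of_eq ?_)
  have : ∑ b, (∑ a, f a * K a b) ^ 2 = N * ∑ a, f a ^ 2 := by
    calc ∑ b, (∑ a, f a * K a b) ^ 2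
        = ∑ b, ∑ a, ∑ a', f a * f a' * (K a b * K a' b) := by
          refine Finset.sum_congr rfl fun b _ => ?_
          rw [sq, Finset.sum_mul_sum]
          exact Finset.sum_congr rfl fun a _ => Finset.sum_congr rfl fun a' _ => by ring
      _ = ∑ a, ∑ a', f a * f a' * ∑ b, K a b * K a' b := by
          rw [Finset.sum_comm]
          refine Finset.sum_congr rfl fun a _ => ?_
          rw [Finset.sum_comm]
          simp only [Finset.mul_sum]
      _ = N * ∑ a, f a ^ 2 := by
          simp only [hK, mul_ite, mul_zero, Finset.sum_ite_eq, Finset.mem_univ, if_true,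
            Finset.mul_sum]
          exact Finset.sum_congr rfl fun a _ => by ring
  rw [this]
  ring

lemma sum_binarySign_mul_binarySign {k : ℕ} (a a' : Fin k → ZMod 2) :
    ∑ b : Fin k → ZMod 2, binarySign (a ⬝ᵥ b) * binarySign (a' ⬝ᵥ b)
      = if a = a' then (2 : ℝ) ^ k else 0 := by
  simp only [← binarySign_add, ← add_dotProduct, sum_binarySign_dotProduct]
  have : a + a' = 0 ↔ a = a' := by
    simp only [funext_iff, Pi.add_apply, Pi.zero_apply, CharTwo.add_eq_zero]
  simp [this]

lemma sum_marginal_sq_le {α β : Type*} [Fintype α] [Fintype β] [DecidableEq α] [DecidableEq β]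
    (F : Finset (α × β)) :
    ∑ a, (∑ b, if (a, b) ∈ F then (1 : ℝ) else 0) ^ 2 ≤ Fintype.card β * F.card := by
  have hF : (F.card : ℝ) = ∑ a, ∑ b, if (a, b) ∈ F then (1 : ℝ) else 0 := by
    rw [← Fintype.sum_prod_type']
    simp
  rw [hF, Finset.mul_sum]
  refine Finset.sum_le_sum fun a _ => ?_
  rw [sq]
  refine mul_le_mul_of_nonneg_right ?_ (Finset.sum_nonneg fun b _ => by split_ifs <;> norm_num)
  calc (∑ b, if (a, b) ∈ F then (1 : ℝ) else 0) ≤ ∑ _b : β, (1 : ℝ) :=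
        Finset.sum_le_sum fun b _ => by split_ifs <;> norm_num
    _ = Fintype.card β := by simp

lemma sq_sum_binarySign_cross_le {k : ℕ} (F : Finset ((Fin k → ZMod 2) × (Fin k → ZMod 2))) :
    (∑ p ∈ F, ∑ q ∈ F, binarySign (p.1 ⬝ᵥ q.2)) ^ 2 ≤ (2 : ℝ) ^ (3 * k) * (F.card : ℝ) ^ 2 := by
  have h := sq_sum_mul_kernel_le (fun a b : Fin k → ZMod 2 => binarySign (a ⬝ᵥ b)) (2 ^ k)
    sum_binarySign_mul_binarySign (fun a => ∑ b, if (a, b) ∈ F then (1 : ℝ) else 0)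
    (fun b => ∑ a, if (a, b) ∈ F then (1 : ℝ) else 0)
  have hl : ∀ φ : (Fin k → ZMod 2) → ℝ,
      ∑ a, (∑ b, if (a, b) ∈ F then (1 : ℝ) else 0) * φ a = ∑ p ∈ F, φ p.1 := by
    intro φ
    simp only [Finset.sum_mul]
    rw [← Fintype.sum_prod_type' (f := fun a b => (if (a, b) ∈ F then (1 : ℝ) else 0) * φ a)]
    simp [ite_mul, Finset.sum_ite_mem]
  have hr : ∀ φ : (Fin k → ZMod 2) → ℝ,
      ∑ b, (∑ a, if (a, b) ∈ F then (1 : ℝ) else 0) * φ b = ∑ p ∈ F, φ p.2 := by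
    intro φ
    simp only [Finset.sum_mul]
    rw [Finset.sum_comm,
      ← Fintype.sum_prod_type' (f := fun a b => (if (a, b) ∈ F then (1 : ℝ) else 0) * φ b)]
    simp [ite_mul, Finset.sum_ite_mem]
  simp only [hl, hr] at h
  rw [Finset.sum_comm]
  refine h.trans ?_
  have h1 := sum_marginal_sq_le F
  have h2 := sum_marginal_sq_le (F.map (Equiv.prodComm _ _).toEmbedding)
  simp only [Finset.mem_map_equiv, Equiv.prodComm_symm, Equiv.prodComm_apply, Prod.swap_prod_mk,
    Finset.card_map] at h2
  have hc : ((Fintype.card (Fin k → ZMod 2) : ℕ) : ℝ) = 2 ^ k := by simp [ZMod.card]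
  rw [hc] at h1 h2
  calc _ ≤ (2 : ℝ) ^ k * (2 ^ k * F.card) * (2 ^ k * F.card) := by gcongr
    _ = _ := by ring

lemma sq_sum_binarySign_symplectic_le {k : ℕ}
    (F : Finset ((Fin k → ZMod 2) × (Fin k → ZMod 2))) :
    (∑ p ∈ F, ∑ q ∈ F, binarySign (p.1 ⬝ᵥ q.2) * binarySign (q.1 ⬝ᵥ p.2)) ^ 2
      ≤ (2 : ℝ) ^ (2 * k) * (F.card : ℝ) ^ 2 := by
  have h := sq_sum_mul_kernel_le
    (fun p q : (Fin k → ZMod 2) × (Fin k → ZMod 2) =>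
      binarySign (p.1 ⬝ᵥ q.2) * binarySign (q.1 ⬝ᵥ p.2)) (2 ^ (2 * k)) ?_
    (fun p => if p ∈ F then (1 : ℝ) else 0) (fun p => if p ∈ F then (1 : ℝ) else 0)
  · simp only [ite_mul, one_mul, zero_mul, Finset.sum_ite_mem, Finset.univ_inter, ite_pow,
      one_pow, ne_eq, OfNat.ofNat_ne_zero, not_false_eq_true, zero_pow, Finset.sum_const,
      nsmul_eq_mul, mul_one] at h
    rw [Finset.sum_comm]
    exact h.trans (le_of_eq (by ring))
  · intro a a'
    calc _ = ∑ x : Fin k → ZMod 2, ∑ y : Fin k → ZMod 2,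
          (binarySign (a.2 ⬝ᵥ x) * binarySign (a'.2 ⬝ᵥ x)) *
            (binarySign (a.1 ⬝ᵥ y) * binarySign (a'.1 ⬝ᵥ y)) := by
          rw [Fintype.sum_prod_type]
          refine Finset.sum_congr rfl fun x _ => Finset.sum_congr rfl fun y _ => ?_
          simp only [dotProduct_comm x]
          ring
      _ = _ := by
          rw [← Finset.sum_mul_sum, sum_binarySign_mul_binarySign, sum_binarySign_mul_binarySign]
          by_cases h1 : a.1 = a'.1 <;> by_cases h2 : a.2 = a'.2 <;>
            simp [h1, h2, Prod.ext_iff, two_mul, pow_add]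

/-- Some pair in `F` is orthogonal to about a quarter of `F`. -/
lemma exists_large_orthogonal_filter {k : ℕ} (F : Finset ((Fin k → ZMod 2) × (Fin k → ZMod 2)))
    (hF : F.Nonempty) {M : ℝ} (hM : 0 ≤ M) (hM2 : M ^ 2 = 2 ^ (3 * k)) :
    ∃ p ∈ F, ((F.card : ℝ) - 3 * M) / 4
      ≤ ({q ∈ F | p.1 ⬝ᵥ q.2 = 0 ∧ q.1 ⬝ᵥ p.2 = 0} : Finset _).card := by
  refine Finset.exists_le_of_sum_le hF ?_
  have hcard : ∀ p : (Fin k → ZMod 2) × (Fin k → ZMod 2),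
      ((({q ∈ F | p.1 ⬝ᵥ q.2 = 0 ∧ q.1 ⬝ᵥ p.2 = 0} : Finset _).card : ℕ) : ℝ)
        = ∑ q ∈ F, (1 + binarySign (p.1 ⬝ᵥ q.2) + binarySign (q.1 ⬝ᵥ p.2)
            + binarySign (p.1 ⬝ᵥ q.2) * binarySign (q.1 ⬝ᵥ p.2)) / 4 := by
    intro p
    rw [Finset.card_filter]
    push_cast
    refine Finset.sum_congr rfl fun q _ => ?_
    by_cases h1 : p.1 ⬝ᵥ q.2 = 0 <;> by_cases h2 : q.1 ⬝ᵥ p.2 = 0 <;>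
      norm_num [h1, h2, binarySign]
  have hcross : -(M * F.card) ≤ ∑ p ∈ F, ∑ q ∈ F, binarySign (p.1 ⬝ᵥ q.2) := by
    refine (abs_le_of_sq_le_sq' ?_ (by positivity)).1
    rw [mul_pow, hM2]
    exact sq_sum_binarySign_cross_le F
  have hsymp : -(M * F.card) ≤
      ∑ p ∈ F, ∑ q ∈ F, binarySign (p.1 ⬝ᵥ q.2) * binarySign (q.1 ⬝ᵥ p.2) := by
    refine (abs_le_of_sq_le_sq' ?_ (by positivity)).1
    rw [mul_pow, hM2]
    refine (sq_sum_binarySign_symplectic_le F).trans ?_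
    gcongr
    · norm_num
    · norm_num
  have hcross' : ∑ p ∈ F, ∑ q ∈ F, binarySign (q.1 ⬝ᵥ p.2)
      = ∑ p ∈ F, ∑ q ∈ F, binarySign (p.1 ⬝ᵥ q.2) := Finset.sum_comm
  simp only [hcard, ← Finset.sum_div, Finset.sum_add_distrib, Finset.sum_const, nsmul_eq_mul,
    mul_one, hcross']
  linarith

lemma exists_pairwise_orthogonal {k : ℕ} {M : ℝ} (hM : 0 < M) (hM2 : M ^ 2 = 2 ^ (3 * k))
    (r : ℕ) (F : Finset ((Fin k → ZMod 2) × (Fin k → ZMod 2)))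
    (hF : M * (4 ^ r - 1) ≤ F.card) :
    ∃ f : Fin r → (Fin k → ZMod 2) × (Fin k → ZMod 2),
      (∀ i, f i ∈ F) ∧ ∀ i j, i ≠ j → (f i).1 ⬝ᵥ (f j).2 = 0 := by
  induction r generalizing F with
  | zero => exact ⟨Fin.elim0, fun i => i.elim0, fun i => i.elim0⟩
  | succ r ih =>
    have h4 : (1 : ℝ) ≤ 4 ^ r := one_le_pow₀ (by norm_num)
    have hne : F.Nonempty := by
      rw [← Finset.card_pos, ← Nat.cast_pos (α := ℝ)]
      refine lt_of_lt_of_le (mul_pos hM ?_) hF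
      rw [pow_succ]
      linarith
    obtain ⟨p, hp, hcard⟩ := exists_large_orthogonal_filter F hne hM.le hM2
    obtain ⟨f, hfF, hf⟩ := ih _ (le_trans (by rw [pow_succ] at hF; linarith) hcard)
    simp only [Finset.mem_filter] at hfF
    refine ⟨Fin.cons p f, fun i => ?_, fun i j hij => ?_⟩
    · cases i using Fin.cases with
      | zero => exact hp
      | succ i => exact (hfF i).1
    · cases i using Fin.cases with
      | zero =>
        cases j using Fin.cases with
        | zero => exact absurd rfl hij
        | succ j => exact (hfF j).2.1
      | succ i =>
        cases j using Fin.cases with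
        | zero => exact (hfF i).2.2
        | succ j => exact hf i j fun h => hij (congrArg Fin.succ h)

theorem stmt9 :
    ∃ c : ℝ, 0 < c ∧ ∀ k r : ℕ, 3 ≤ k → 2 ≤ r →
      ∀ F : Finset ((Fin k → ZMod 2) × (Fin k → ZMod 2)),
        (∀ p ∈ F, ∑ i, p.1 i * p.2 i = 1) →
        c * (2 : ℝ) ^ (3 * (k : ℝ) / 2 + 2 * (r : ℝ)) ≤ (F.card : ℝ) →
        ∃ f : Fin r → (Fin k → ZMod 2) × (Fin k → ZMod 2),
          Function.Injective f ∧ (∀ i, f i ∈ F) ∧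
          ∀ i j : Fin r, i ≠ j → ∑ t, (f i).1 t * (f j).2 t = 0 := by
  refine ⟨1, one_pos, fun k r _ _ F hF hcard => ?_⟩
  have hM : 0 < (2 : ℝ) ^ (3 * (k : ℝ) / 2) := by positivity
  have hM2 : ((2 : ℝ) ^ (3 * (k : ℝ) / 2)) ^ 2 = 2 ^ (3 * k) := by
    rw [← Real.rpow_natCast, ← Real.rpow_mul (by norm_num), ← Real.rpow_natCast]
    congr 1
    push_cast
    ring
  have hr : (2 : ℝ) ^ (2 * (r : ℝ)) = 4 ^ r := by
    rw [Real.rpow_mul (by norm_num), Real.rpow_natCast]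
    norm_num
  rw [one_mul, Real.rpow_add (by norm_num), hr] at hcard
  obtain ⟨f, hfF, hf⟩ := exists_pairwise_orthogonal hM hM2 r F (by linarith)
  refine ⟨f, fun i j hij => ?_, hfF, hf⟩
  by_contra hne
  have h0 := hf i j hne
  rw [← hij] at h0
  exact zero_ne_one (h0.symm.trans (hF _ (hfF i)))
end

section
/- Let k and ℓ be integers with 0 ≤ ℓ ≤ k, and let W₁, W₂ ⊆ F₂^k be linear subspaces each of dimension at least k − ℓ. Then the number of pairs (w₁, w₂) ∈ W₁ × W₂ with ⟨w₁, w₂⟩ = 1 is at least (2^{k−ℓ} − 2^ℓ) · 2^{k−ℓ−1} (an inequality of real numbers). -/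
open Finset BigOperators

/-- The orthogonal complement of `W` under the standard bilinear form has complementary
dimension. -/
lemma finrank_orthogonal_dotProduct {K : Type*} [Field K] {k : ℕ} (W : Submodule K (Fin k → K)) :
    Module.finrank K ((Matrix.toBilin' (1 : Matrix (Fin k) (Fin k) K)).orthogonal W)
      = k - Module.finrank K W := by
  have hn : (Matrix.toBilin' (1 : Matrix (Fin k) (Fin k) K)).Nondegenerate :=
    (Matrix.nondegenerate_of_det_ne_zero (by simp)).toBilin'
  simpa using LinearMap.BilinForm.finrank_orthogonal hn W

/-- A nonzero linear functional over `ZMod 2` takes the value `1` on exactly half of the space. -/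
lemma two_mul_card_filter_dotProduct_eq_one {k : ℕ} (W : Submodule (ZMod 2) (Fin k → ZMod 2))
    [DecidablePred (· ∈ W)] (x a : Fin k → ZMod 2) (ha : a ∈ W) (hxa : x ⬝ᵥ a = 1) :
    2 * #{y | y ∈ W ∧ x ⬝ᵥ y = 1} = #{y | y ∈ W} := by
  have hcard : #{y | y ∈ W ∧ x ⬝ᵥ y = 1} = #{y | y ∈ W ∧ ¬ x ⬝ᵥ y = 1} := by
    refine Finset.card_bij (fun y _ => y + a) ?_ (fun _ _ _ _ h => add_right_cancel h) ?_
    · intro y hy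
      simp only [mem_filter, mem_univ, true_and] at hy ⊢
      refine ⟨W.add_mem hy.1 ha, ?_⟩
      rw [dotProduct_add, hy.2, hxa]
      decide
    · intro y hy
      simp only [mem_filter, mem_univ, true_and] at hy
      refine ⟨y - a, ?_, sub_add_cancel y a⟩
      simp only [mem_filter, mem_univ, true_and]
      refine ⟨W.sub_mem hy.1 ha, ?_⟩
      rw [dotProduct_sub, hxa]
      have h := hy.2
      revert h
      generalize x ⬝ᵥ y = c
      revert c
      decide
  rw [← Finset.card_filter_add_card_filter_not (s := {y | y ∈ W}) (fun y => x ⬝ᵥ y = 1),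
    filter_filter, filter_filter, ← hcard, two_mul]

lemma card_filter_mem_submodule {k : ℕ} (W : Submodule (ZMod 2) (Fin k → ZMod 2))
    [DecidablePred (· ∈ W)] : #{y | y ∈ W} = 2 ^ Module.finrank (ZMod 2) W := by
  have h := Module.natCard_eq_pow_finrank (K := ZMod 2) (V := W)
  rw [Nat.card_zmod] at h
  rw [← h, Nat.card_eq_fintype_card, Fintype.card_subtype]

lemma card_dotProduct_eq_one_lower_bound {k : ℕ}
    (W₁ W₂ : Submodule (ZMod 2) (Fin k → ZMod 2)) :
    2 ^ Module.finrank (ZMod 2) W₁ * 2 ^ Module.finrank (ZMod 2) W₂ ≤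
      2 * {p : (Fin k → ZMod 2) × (Fin k → ZMod 2) |
          p.1 ∈ W₁ ∧ p.2 ∈ W₂ ∧ p.1 ⬝ᵥ p.2 = 1}.ncard
        + 2 ^ (k - Module.finrank (ZMod 2) W₂) * 2 ^ Module.finrank (ZMod 2) W₂ := by
  classical
  set P := (Matrix.toBilin' (1 : Matrix (Fin k) (Fin k) (ZMod 2))).orthogonal W₂
  have hN : {p : (Fin k → ZMod 2) × (Fin k → ZMod 2) |
      p.1 ∈ W₁ ∧ p.2 ∈ W₂ ∧ p.1 ⬝ᵥ p.2 = 1}.ncard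
      = ∑ x with x ∈ W₁, #{y | y ∈ W₂ ∧ x ⬝ᵥ y = 1} := by
    rw [Set.ncard_eq_toFinset_card', ← Finset.card_sigma]
    refine Finset.card_bij (fun p _ => ⟨p.1, p.2⟩) ?_ ?_ ?_
    · intro p hp
      simpa using hp
    · rintro ⟨a, b⟩ _ ⟨c, d⟩ _ h
      simpa using h
    · rintro ⟨a, b⟩ h
      exact ⟨(a, b), by simpa using h, rfl⟩
  have hfiber (x : Fin k → ZMod 2) :
      #{y | y ∈ W₂} ≤ 2 * #{y | y ∈ W₂ ∧ x ⬝ᵥ y = 1} + if x ∈ P then #{y | y ∈ W₂} else 0 := by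
    by_cases hx : x ∈ P
    · simp [hx]
    · have : ∃ a ∈ W₂, x ⬝ᵥ a = 1 := by
        by_contra! hcon
        refine hx (LinearMap.BilinForm.mem_orthogonal_iff.2 fun y hy => ?_)
        have h := hcon y hy
        rw [Matrix.toBilin'_apply', Matrix.one_mulVec,
          dotProduct_comm]
        revert h
        generalize x ⬝ᵥ y = c
        revert c
        decide
      obtain ⟨a, ha, hxa⟩ := this
      rw [two_mul_card_filter_dotProduct_eq_one W₂ x a ha hxa]
      exact Nat.le_add_right _ _
  have hsum := Finset.sum_le_sum (s := {x | x ∈ W₁}) fun x _ => hfiber x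
  rw [Finset.sum_const, smul_eq_mul, Finset.sum_add_distrib, ← Finset.mul_sum, ← hN,
    ← Finset.sum_filter, Finset.sum_const, smul_eq_mul, card_filter_mem_submodule,
    card_filter_mem_submodule] at hsum
  refine hsum.trans ?_
  gcongr
  rw [← finrank_orthogonal_dotProduct W₂, ← card_filter_mem_submodule]
  exact card_le_card fun x hx => mem_filter.2 ⟨mem_univ x, (mem_filter.1 hx).2⟩

theorem stmt10 (k ℓ : ℕ) (hlk : ℓ ≤ k)
    (W₁ W₂ : Submodule (ZMod 2) (Fin k → ZMod 2))
    (h1 : k - ℓ ≤ Module.finrank (ZMod 2) W₁)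
    (h2 : k - ℓ ≤ Module.finrank (ZMod 2) W₂) :
    ((2 : ℝ) ^ ((k : ℝ) - (ℓ : ℝ)) - (2 : ℝ) ^ (ℓ : ℝ)) * (2 : ℝ) ^ ((k : ℝ) - (ℓ : ℝ) - 1) ≤
      (({p : (Fin k → ZMod 2) × (Fin k → ZMod 2) |
          p.1 ∈ W₁ ∧ p.2 ∈ W₂ ∧ ∑ i, p.1 i * p.2 i = 1}).ncard : ℝ) := by
  have key := card_dotProduct_eq_one_lower_bound W₁ W₂
  simp only [dotProduct] at key
  set N := {p : (Fin k → ZMod 2) × (Fin k → ZMod 2) |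
    p.1 ∈ W₁ ∧ p.2 ∈ W₂ ∧ ∑ i, p.1 i * p.2 i = 1}.ncard
  rw [Real.rpow_sub_one two_ne_zero, ← Nat.cast_sub hlk, Real.rpow_natCast, Real.rpow_natCast]
  have key' : (2 : ℝ) ^ Module.finrank (ZMod 2) W₁ * 2 ^ Module.finrank (ZMod 2) W₂ ≤
      2 * N + 2 ^ (k - Module.finrank (ZMod 2) W₂) * 2 ^ Module.finrank (ZMod 2) W₂ := by
    exact_mod_cast key
  have ha : (2 : ℝ) ^ (k - ℓ) ≤ 2 ^ Module.finrank (ZMod 2) W₁ :=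
    pow_le_pow_right₀ one_le_two h1
  have hb : (2 : ℝ) ^ (k - ℓ) ≤ 2 ^ Module.finrank (ZMod 2) W₂ :=
    pow_le_pow_right₀ one_le_two h2
  have hc : (2 : ℝ) ^ (k - Module.finrank (ZMod 2) W₂) ≤ 2 ^ ℓ :=
    pow_le_pow_right₀ one_le_two (by omega)
  have hpos : (0 : ℝ) < 2 ^ (k - ℓ) := by positivity
  rcases le_total ((2 : ℝ) ^ (k - ℓ)) (2 ^ ℓ) with h | h
  · exact (mul_nonpos_of_nonpos_of_nonneg (sub_nonpos.2 h) (by positivity)).trans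
      (Nat.cast_nonneg N)
  · have := mul_le_mul (sub_le_sub ha hc) hb hpos.le (by linarith)
    linarith
end

section
/- For every finite simple graph G on vertex set V = {1, …, n}, the minimum integer ℓ for which there exists a linear index code of length ℓ for G equals minrk₂(G). -/
open Finset BigOperators

/-- `M` represents the graph `G` over `F₂`: ones on the diagonal and zeros at
non-adjacent off-diagonal positions. -/
def Matrix.RepresentsGraph {V : Type*} [Fintype V] [DecidableEq V]
    (M : Matrix V V (ZMod 2)) (G : SimpleGraph V) : Prop :=
  (∀ i, M i i = 1) ∧ ∀ i j, i ≠ j → ¬ G.Adj i j → M i j = 0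

/-- The minrank of `G` over `F₂`. -/
noncomputable def minrk2 {V : Type*} [Fintype V] [DecidableEq V] (G : SimpleGraph V) : ℕ :=
  sInf {r : ℕ | ∃ M : Matrix V V (ZMod 2), M.RepresentsGraph G ∧ M.rank = r}

/-- `E` is (the encoding map of) a linear index code of length `ℓ` for `G`:
every receiver `i` can linearly decode `x i` from `E x` together with the
restriction of `x` to the neighborhood of `i`. -/
def IsLinearIndexCode {V : Type*} [Fintype V] (G : SimpleGraph V) (ℓ : ℕ)
    (E : (V → ZMod 2) →ₗ[ZMod 2] (Fin ℓ → ZMod 2)) : Prop :=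
  ∀ i : V, ∃ D : ((Fin ℓ → ZMod 2) × ({w : V // G.Adj i w} → ZMod 2)) →ₗ[ZMod 2] ZMod 2,
    ∀ x : V → ZMod 2, D (E x, fun w => x w.1) = x i

theorem Matrix.RepresentsGraph.mulVec_apply {V : Type*} [Fintype V] [DecidableEq V]
    {G : SimpleGraph V} {M : Matrix V V (ZMod 2)} (hM : M.RepresentsGraph G)
    (x : V → ZMod 2) (i : V) [Fintype {w : V // G.Adj i w}] :
    M.mulVec x i = x i + ∑ w : {w : V // G.Adj i w}, M i w * x w := by
  classical
  have hsum : ∑ w : {w : V // G.Adj i w}, M i w * x w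
      = ∑ j, if G.Adj i j then M i j * x j else 0 := by
    rw [← Finset.sum_filter]
    exact (Finset.sum_subtype _ (by simp) fun j => M i j * x j).symm
  have hx : x i = ∑ j, if i = j then x j else 0 := by simp
  rw [hsum, hx, ← Finset.sum_add_distrib]
  refine Finset.sum_congr rfl fun j _ => ?_
  by_cases hij : i = j
  · subst hij
    simp [hM.1]
  · by_cases hadj : G.Adj i j
    · simp [hij, hadj]
    · simp [hij, hadj, hM.2 i j hij hadj]

/-- A matrix representing `G` yields a linear index code whose length is its rank. -/
theorem Matrix.RepresentsGraph.exists_isLinearIndexCode {V : Type*} [Fintype V] [DecidableEq V]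
    {G : SimpleGraph V} {M : Matrix V V (ZMod 2)} (hM : M.RepresentsGraph G) :
    ∃ E : (V → ZMod 2) →ₗ[ZMod 2] (Fin M.rank → ZMod 2), IsLinearIndexCode G M.rank E := by
  classical
  let e : LinearMap.range M.mulVecLin ≃ₗ[ZMod 2] (Fin M.rank → ZMod 2) :=
    LinearEquiv.ofFinrankEq _ _ (by rw [Module.finrank_fin_fun, Matrix.rank])
  refine ⟨e.toLinearMap ∘ₗ M.mulVecLin.rangeRestrict, fun i => ?_⟩
  refine ⟨(LinearMap.proj i ∘ₗ (LinearMap.range M.mulVecLin).subtype ∘ₗ e.symm.toLinearMap) ∘ₗ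
      LinearMap.fst _ _ _ -
    (∑ w : {w : V // G.Adj i w}, M i w • LinearMap.proj w) ∘ₗ LinearMap.snd _ _ _, fun x => ?_⟩
  simp [hM.mulVec_apply]

/-- A linear index code of length `ℓ` for `G` yields a matrix of rank at most `ℓ`
representing `G`. -/
theorem IsLinearIndexCode.exists_representsGraph {V : Type*} [Fintype V] [DecidableEq V]
    {G : SimpleGraph V} {ℓ : ℕ} {E : (V → ZMod 2) →ₗ[ZMod 2] (Fin ℓ → ZMod 2)}
    (hE : IsLinearIndexCode G ℓ E) :
    ∃ M : Matrix V V (ZMod 2), M.RepresentsGraph G ∧ M.rank ≤ ℓ := by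
  choose D hD using hE
  let F : (Fin ℓ → ZMod 2) →ₗ[ZMod 2] (V → ZMod 2) :=
    LinearMap.pi fun i => D i ∘ₗ LinearMap.inl _ _ _
  have key (i j : V) (hadj : ¬ G.Adj i j) :
      LinearMap.toMatrix' (F ∘ₗ E) i j = (Pi.single j 1 : V → ZMod 2) i := by
    have hside : (fun w : {w : V // G.Adj i w} => (Pi.single j 1 : V → ZMod 2) w) = 0 := by
      funext w
      refine Pi.single_eq_of_ne (fun h => hadj ?_) _
      rw [← h]
      exact w.2
    rw [← hD i (Pi.single j 1), hside, LinearMap.toMatrix'_apply]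
    rfl
  refine ⟨LinearMap.toMatrix' (F ∘ₗ E), ⟨fun i => ?_, fun i j hij hadj => ?_⟩, ?_⟩
  · simp [key i i G.irrefl]
  · simp [key i j hadj, hij]
  · rw [LinearMap.toMatrix'_comp]
    exact (Matrix.rank_mul_le_right _ _).trans
      (by simpa using Matrix.rank_le_card_height (LinearMap.toMatrix' E))

theorem stmt11 {V : Type*} [Fintype V] [DecidableEq V] (G : SimpleGraph V) :
    IsLeast {ℓ : ℕ | ∃ E : (V → ZMod 2) →ₗ[ZMod 2] (Fin ℓ → ZMod 2),
      IsLinearIndexCode G ℓ E} (minrk2 G) := by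
  have hne : {r : ℕ | ∃ M : Matrix V V (ZMod 2), M.RepresentsGraph G ∧ M.rank = r}.Nonempty :=
    ⟨_, 1, ⟨fun i => Matrix.one_apply_eq i, fun _ _ h _ => Matrix.one_apply_ne h⟩, rfl⟩
  refine ⟨?_, ?_⟩
  · obtain ⟨M, hM, hr⟩ := Nat.sInf_mem hne
    rw [minrk2, ← hr]
    exact hM.exists_isLinearIndexCode
  · rintro ℓ ⟨E, hE⟩
    obtain ⟨M, hM, hr⟩ := hE.exists_representsGraph
    rw [minrk2]
    exact le_trans (Nat.sInf_le ⟨M, hM, rfl⟩) hr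
end

section
/- For every finite simple graph G on vertex set V and every (not necessarily linear) index code of length ℓ for G over the binary alphabet, one has ℓ ≥ α(G), the independence number of G. (That is, α(G) ≤ β₁(G).) -/
open Finset BigOperators

/-- The independence number of `G`: the maximum size of a set of pairwise
non-adjacent vertices. -/
noncomputable def indepNum {V : Type*} [Fintype V] (G : SimpleGraph V) : ℕ :=
  sSup {n : ℕ | ∃ T : Finset V, T.card = n ∧ ∀ a ∈ T, ∀ b ∈ T, a ≠ b → ¬ G.Adj a b}

/-- `E` is (the encoding map of) an index code of length `ℓ` for `G` over the binary
alphabet: every receiver `i` can decode `x i` from `E x` together with the restriction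
of `x` to the neighborhood of `i`. -/
def IsIndexCode {V : Type*} (G : SimpleGraph V) (ℓ : ℕ)
    (E : (V → Bool) → (Fin ℓ → Bool)) : Prop :=
  ∀ i : V, ∃ D : (Fin ℓ → Bool) × ({w : V // G.Adj i w} → Bool) → Bool,
    ∀ x : V → Bool, D (E x, fun w => x w.1) = x i

/-- The coordinates in an independent set can be recovered from the codeword alone, so an
independent set has at most `ℓ` elements. -/
theorem IsIndexCode.card_le_of_indep {V : Type*} {G : SimpleGraph V} {ℓ : ℕ}
    {E : (V → Bool) → (Fin ℓ → Bool)} (hE : IsIndexCode G ℓ E) {T : Finset V}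
    (hT : ∀ a ∈ T, ∀ b ∈ T, a ≠ b → ¬ G.Adj a b) : T.card ≤ ℓ := by
  classical
  let extend : (T → Bool) → V → Bool := fun y v => if h : v ∈ T then y ⟨v, h⟩ else false
  have hinj : Function.Injective (E ∘ extend) := by
    intro y z hyz
    funext i
    obtain ⟨D, hD⟩ := hE i
    have hside : (fun w : {w : V // G.Adj i w} => extend y w) =
        fun w => extend z w.1 := by
      funext w
      have hw : w.1 ∉ T := fun h => hT i i.2 w h (G.ne_of_adj w.2) w.2
      simp [extend, hw]
    have hi : extend y i = extend z i := by
      rw [← hD (extend y), ← hD (extend z), hside, show E (extend y) = E (extend z) from hyz]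
    simpa [extend] using hi
  have hcard := Fintype.card_le_of_injective _ hinj
  simp only [Fintype.card_fun, Fintype.card_bool, Fintype.card_coe, Fintype.card_fin] at hcard
  exact (Nat.pow_le_pow_iff_right one_lt_two).mp hcard

theorem stmt14 {V : Type*} [Fintype V] (G : SimpleGraph V) (ℓ : ℕ)
    (E : (V → Bool) → (Fin ℓ → Bool)) (hE : IsIndexCode G ℓ E) :
    indepNum G ≤ ℓ := by
  refine csSup_le ⟨0, ∅, by simp⟩ ?_
  rintro _ ⟨T, rfl, hT⟩
  exact hE.card_le_of_indep hT
end
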